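/- For all real parameters c₁, c₂, c₃, the fourth moment of the Bell-diagonal matrix ρ_BD(c₁,c₂,c₃) satisfies R^(4) = (2/75)(c₁⁴ + c₂⁴ + c₃⁴) + (27/25)(R^(2))², where R^(2) = (c₁² + c₂² + c₃²)/9; equivalently R^(4) = (2(c₁⁴+c₂⁴+c₃⁴) + (c₁²+c₂²+c₃²)²)/75. -/

import Mathlib

open MeasureTheory Matrix Kronecker

noncomputable section

abbrev E3 : Type := EuclideanSpace ℝ (Fin 3)

/-- The unit sphere `S²` in `ℝ³`. -/
abbrev S2 : Type := Metric.sphere (0 : E3) 1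

/-- The action of a linear isometry (rotation) of `ℝ³` on the unit sphere. -/
def sphereMap (f : E3 ≃ₗᵢ[ℝ] E3) (x : S2) : S2 :=
  ⟨f x, by
    have h : ‖(x : E3)‖ = 1 := by simpa using mem_sphere_zero_iff_norm.mp x.2
    simp [mem_sphere_zero_iff_norm, h]⟩

/-- The three Pauli matrices `σ_x, σ_y, σ_z`. -/
def pauli : Fin 3 → Matrix (Fin 2) (Fin 2) ℂ
  | 0 => !![0, 1; 1, 0]
  | 1 => !![0, -Complex.I; Complex.I, 0]
  | 2 => !![1, 0; 0, -1]

/-- For a direction `u ∈ ℝ³`, the operator `σ_u = u₁σ₁ + u₂σ₂ + u₃σ₃`. -/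
def pauliVec (u : Fin 3 → ℝ) : Matrix (Fin 2) (Fin 2) ℂ :=
  ∑ j, (u j : ℂ) • pauli j

/-- The coordinates of a point of the unit sphere `S²`. -/
def coords (x : S2) : Fin 3 → ℝ := fun j => (x : E3) j

/-- The Bell-diagonal matrix `ρ_BD = (1/4)(I₄ + Σ_j c_j σ_j ⊗ σ_j)`. -/
def rhoBD (c₁ c₂ c₃ : ℝ) : Matrix (Fin 2 × Fin 2) (Fin 2 × Fin 2) ℂ :=
  (1 / 4 : ℂ) • (1 + (c₁ : ℂ) • (pauli 0 ⊗ₖ pauli 0) + (c₂ : ℂ) • (pauli 1 ⊗ₖ pauli 1)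
    + (c₃ : ℂ) • (pauli 2 ⊗ₖ pauli 2))

/-- The `t`-th moment `R^(t) = ∬_{S²×S²} (Tr[ρ (σ_u ⊗ σ_w)])^t dμ(u) dμ(w)` of a two-qubit
matrix `ρ` with respect to a measure `μ` on the sphere. -/
def twoQubitMoment (μ : Measure S2) (ρ : Matrix (Fin 2 × Fin 2) (Fin 2 × Fin 2) ℂ)
    (t : ℕ) : ℝ :=
  ∫ p : S2 × S2,
    ((ρ * (pauliVec (coords p.1) ⊗ₖ pauliVec (coords p.2))).trace).re ^ t ∂(μ.prod μ)

lemma norm_sq_eq_sum_three (v : E3) : ‖v‖ ^ 2 = v 0 ^ 2 + v 1 ^ 2 + v 2 ^ 2 := by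
  simp [EuclideanSpace.norm_sq_eq, Fin.sum_univ_three]

lemma norm_pow_four_eq (v : E3) : ‖v‖ ^ 4 = (v 0 ^ 2 + v 1 ^ 2 + v 2 ^ 2) ^ 2 := by
  rw [← norm_sq_eq_sum_three]
  ring

lemma inner_eq_sum_three (v x : E3) :
    inner ℝ v x = v 0 * x 0 + v 1 * x 1 + v 2 * x 2 := by
  simp [PiLp.inner_apply, Fin.sum_univ_three, mul_comm]

lemma continuous_sphereMap (f : E3 ≃ₗᵢ[ℝ] E3) : Continuous (sphereMap f) :=
  (f.continuous.comp continuous_subtype_val).subtype_mk _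

lemma integrable_of_continuous_of_compactSpace {X : Type*} [TopologicalSpace X] [CompactSpace X]
    [MeasurableSpace X] [OpensMeasurableSpace X] (μ : Measure X) [IsFiniteMeasure μ]
    {f : X → ℝ} (hf : Continuous f) : Integrable f μ :=
  hf.integrable_of_hasCompactSupport (HasCompactSupport.of_compactSpace f)

/-- Directional moments of a rotation-invariant measure depend only on the norm of the vector. -/
lemma integral_inner_pow_eq_of_norm_eq (μ : Measure S2)
    (hinv : ∀ f : E3 ≃ₗᵢ[ℝ] E3, μ.map (sphereMap f) = μ) (t : ℕ) {v w : E3} (h : ‖v‖ = ‖w‖) :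
    ∫ x : S2, (inner ℝ v (x : E3)) ^ t ∂μ = ∫ x : S2, (inner ℝ w (x : E3)) ^ t ∂μ := by
  set f : E3 ≃ₗᵢ[ℝ] E3 := (ℝ ∙ (v - w))ᗮ.reflection
  have hf : f v = w := Submodule.reflection_sub h
  have hc : Continuous fun x : S2 => (inner ℝ w (x : E3)) ^ t := by fun_prop
  rw [← hinv f, integral_map (continuous_sphereMap f).aemeasurable hc.aestronglyMeasurable, hinv f]
  refine integral_congr_ae (.of_forall fun x => ?_)
  change inner ℝ v (x : E3) ^ t = inner ℝ w (f x) ^ t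
  rw [← hf, f.inner_map_map]

/-- Directional moments of a rotation-invariant measure are homogeneous in the norm. -/
lemma integral_inner_pow_eq_norm_pow_mul (μ : Measure S2)
    (hinv : ∀ f : E3 ≃ₗᵢ[ℝ] E3, μ.map (sphereMap f) = μ) (t : ℕ) (v : E3) :
    ∫ x : S2, (inner ℝ v (x : E3)) ^ t ∂μ = ‖v‖ ^ t * ∫ x : S2, (x : E3) 0 ^ t ∂μ := by
  rw [integral_inner_pow_eq_of_norm_eq μ hinv t
    (w := ‖v‖ • EuclideanSpace.single 0 1) (by simp [norm_smul]), ← integral_const_mul]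
  simp [inner_smul_left, mul_pow, EuclideanSpace.inner_single_left]

lemma integral_coord_pow_four_eq (μ : Measure S2)
    (hinv : ∀ f : E3 ≃ₗᵢ[ℝ] E3, μ.map (sphereMap f) = μ) (i : Fin 3) :
    ∫ x : S2, (x : E3) i ^ 4 ∂μ = ∫ x : S2, (x : E3) 0 ^ 4 ∂μ := by
  simpa [EuclideanSpace.inner_single_left] using
    integral_inner_pow_eq_norm_pow_mul μ hinv 4 (EuclideanSpace.single i 1)

lemma integral_coord_sq_mul_sq_eq (μ : Measure S2) [IsFiniteMeasure μ]
    (hinv : ∀ f : E3 ≃ₗᵢ[ℝ] E3, μ.map (sphereMap f) = μ) {i j : Fin 3} (hij : i ≠ j) :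
    ∫ x : S2, (x : E3) i ^ 2 * (x : E3) j ^ 2 ∂μ = (∫ x : S2, (x : E3) 0 ^ 4 ∂μ) / 3 := by
  set e : Fin 3 → E3 := fun k => EuclideanSpace.single k 1
  have horth : inner ℝ (e i) (e j) = 0 := by simp [e, EuclideanSpace.inner_single_left, hij]
  have hadd : ‖e i + e j‖ ^ 4 = 4 := by
    have h : ‖e i + e j‖ ^ 2 = 2 := by
      rw [norm_add_sq_real, horth]; norm_num [e]
    rw [show 4 = 2 * 2 from rfl, pow_mul, h]; norm_num
  have hsub : ‖e i - e j‖ ^ 4 = 4 := by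
    have h : ‖e i - e j‖ ^ 2 = 2 := by
      rw [norm_sub_sq_real, horth]; norm_num [e]
    rw [show 4 = 2 * 2 from rfl, pow_mul, h]; norm_num
  have hplus := integral_inner_pow_eq_norm_pow_mul μ hinv 4 (e i + e j)
  have hminus := integral_inner_pow_eq_norm_pow_mul μ hinv 4 (e i - e j)
  have hi := integral_coord_pow_four_eq μ hinv i
  have hj := integral_coord_pow_four_eq μ hinv j
  rw [hadd] at hplus
  rw [hsub] at hminus
  have hpolar : ∀ x : S2, (x : E3) i ^ 2 * (x : E3) j ^ 2 =
      (1 / 12) * (inner ℝ (e i + e j) (x : E3) ^ 4 + inner ℝ (e i - e j) (x : E3) ^ 4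
        - 2 * ((x : E3) i ^ 4 + (x : E3) j ^ 4)) := by
    intro x
    simp only [e, inner_add_left, inner_sub_left, EuclideanSpace.inner_single_left, map_one, one_mul]
    ring
  simp_rw [hpolar]
  rw [integral_const_mul, integral_sub, integral_add, integral_const_mul, integral_add, hplus,
    hminus, hi, hj]
  · ring
  all_goals exact integrable_of_continuous_of_compactSpace μ (by fun_prop)

/-- Expansion of the integral of the square of a diagonal quadratic form on the sphere. -/
lemma integral_sq_diagonal_form (μ : Measure S2) [IsFiniteMeasure μ]
    (hinv : ∀ f : E3 ≃ₗᵢ[ℝ] E3, μ.map (sphereMap f) = μ) (a b c : ℝ) :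
    ∫ x : S2, (a * (x : E3) 0 ^ 2 + b * (x : E3) 1 ^ 2 + c * (x : E3) 2 ^ 2) ^ 2 ∂μ =
      (2 * (a ^ 2 + b ^ 2 + c ^ 2) + (a + b + c) ^ 2) / 3 * ∫ x : S2, (x : E3) 0 ^ 4 ∂μ := by
  have hexp : ∀ x : S2,
      (a * (x : E3) 0 ^ 2 + b * (x : E3) 1 ^ 2 + c * (x : E3) 2 ^ 2) ^ 2 =
      a ^ 2 * (x : E3) 0 ^ 4 + b ^ 2 * (x : E3) 1 ^ 4 + c ^ 2 * (x : E3) 2 ^ 4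
        + 2 * a * b * ((x : E3) 0 ^ 2 * (x : E3) 1 ^ 2)
        + 2 * a * c * ((x : E3) 0 ^ 2 * (x : E3) 2 ^ 2)
        + 2 * b * c * ((x : E3) 1 ^ 2 * (x : E3) 2 ^ 2) := fun x => by ring
  simp_rw [hexp]
  rw [integral_add, integral_add, integral_add, integral_add, integral_add]
  · simp only [integral_const_mul]
    rw [integral_coord_pow_four_eq μ hinv 1, integral_coord_pow_four_eq μ hinv 2,
      integral_coord_sq_mul_sq_eq μ hinv (i := 0) (j := 1) (by decide),
      integral_coord_sq_mul_sq_eq μ hinv (i := 0) (j := 2) (by decide),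
      integral_coord_sq_mul_sq_eq μ hinv (i := 1) (j := 2) (by decide)]
    ring
  all_goals exact integrable_of_continuous_of_compactSpace μ (by fun_prop)

lemma integral_coord_zero_pow_four (μ : Measure S2) [IsProbabilityMeasure μ]
    (hinv : ∀ f : E3 ≃ₗᵢ[ℝ] E3, μ.map (sphereMap f) = μ) :
    ∫ x : S2, (x : E3) 0 ^ 4 ∂μ = 1 / 5 := by
  have h := integral_sq_diagonal_form μ hinv 1 1 1
  have hone : ∀ x : S2,
      (1 * (x : E3) 0 ^ 2 + 1 * (x : E3) 1 ^ 2 + 1 * (x : E3) 2 ^ 2) ^ 2 = 1 := by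
    intro x
    have hx := norm_sq_eq_sum_three (x : E3)
    rw [norm_eq_of_mem_sphere] at hx
    simp only [one_mul, ← hx]
    norm_num
  simp_rw [hone] at h
  norm_num at h
  linarith

/-- The correlation function of a Bell-diagonal matrix. -/
lemma trace_rhoBD_mul_pauliVec (c₁ c₂ c₃ : ℝ) (u w : Fin 3 → ℝ) :
    ((rhoBD c₁ c₂ c₃ * (pauliVec u ⊗ₖ pauliVec w)).trace).re =
      c₁ * w 0 * u 0 + c₂ * w 1 * u 1 + c₃ * w 2 * u 2 := by
  simp [rhoBD, pauliVec, pauli, Matrix.trace, Matrix.mul_apply, Fintype.sum_prod_type,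
    Fin.sum_univ_three, Fin.sum_univ_two, Matrix.one_apply, Matrix.kroneckerMap_apply]
  ring

/-- for all real `c₁, c₂, c₃`, the fourth moment of the Bell-diagonal matrix
`ρ_BD(c₁,c₂,c₃)` satisfies `R^(4) = (2/75)(c₁⁴+c₂⁴+c₃⁴) + (27/25)(R^(2))²` with
`R^(2) = (c₁²+c₂²+c₃²)/9`; equivalently
`R^(4) = (2(c₁⁴+c₂⁴+c₃⁴) + (c₁²+c₂²+c₃²)²)/75`. Here `μ` is the rotation-invariant
(uniform) probability measure on `S²`. -/
theorem bellDiagonal_fourth_moment (c₁ c₂ c₃ : ℝ)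
    (μ : Measure S2) [IsProbabilityMeasure μ]
    (hinv : ∀ f : E3 ≃ₗᵢ[ℝ] E3, μ.map (sphereMap f) = μ) :
    twoQubitMoment μ (rhoBD c₁ c₂ c₃) 4 =
        (2 / 75) * (c₁ ^ 4 + c₂ ^ 4 + c₃ ^ 4) +
          (27 / 25) * ((c₁ ^ 2 + c₂ ^ 2 + c₃ ^ 2) / 9) ^ 2 ∧
      twoQubitMoment μ (rhoBD c₁ c₂ c₃) 4 =
        (2 * (c₁ ^ 4 + c₂ ^ 4 + c₃ ^ 4) + (c₁ ^ 2 + c₂ ^ 2 + c₃ ^ 2) ^ 2) / 75 := by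
  have hmoment : twoQubitMoment μ (rhoBD c₁ c₂ c₃) 4 =
      (2 * (c₁ ^ 4 + c₂ ^ 4 + c₃ ^ 4) + (c₁ ^ 2 + c₂ ^ 2 + c₃ ^ 2) ^ 2) / 75 := by
    have hinner : ∀ w : S2,
        ∫ u : S2, (c₁ * (w : E3) 0 * (u : E3) 0 + c₂ * (w : E3) 1 * (u : E3) 1
          + c₃ * (w : E3) 2 * (u : E3) 2) ^ 4 ∂μ =
        (c₁ ^ 2 * (w : E3) 0 ^ 2 + c₂ ^ 2 * (w : E3) 1 ^ 2 + c₃ ^ 2 * (w : E3) 2 ^ 2) ^ 2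
          * (1 / 5) := by
      intro w
      have h := integral_inner_pow_eq_norm_pow_mul μ hinv 4
        !₂[c₁ * (w : E3) 0, c₂ * (w : E3) 1, c₃ * (w : E3) 2]
      rw [integral_coord_zero_pow_four μ hinv, norm_pow_four_eq] at h
      simpa [inner_eq_sum_three, mul_pow] using h
    simp only [twoQubitMoment, trace_rhoBD_mul_pauliVec, coords]
    rw [integral_prod_symm _ (integrable_of_continuous_of_compactSpace _ (by fun_prop))]
    simp_rw [hinner]
    rw [integral_mul_const, integral_sq_diagonal_form μ hinv, integral_coord_zero_pow_four μ hinv]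
    ring
  exact ⟨by rw [hmoment]; ring, hmoment⟩
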